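/- arXiv:1512.02632 — 2 statements merged into one kernel-verified Lean document; each statement's English description precedes it below -/
import Mathlib

section
/- Let E = ℂ² with the standard Hermitian norm, let μ > 0 and λ > 0, define V : E → ℝ by V(v) = −(μ/2)‖v‖² + (λ/2)‖v‖⁴, and let v₀ = (0, √(μ/(2λ))). Then the second derivative at t = 0 of the real function t ↦ V(v₀ + t·u) equals 2μ for the direction u = (0,1), and equals 0 for each of the directions u = (1,0), u = (i,0), and u = (0,i). (Hence the Hessian of V at v₀ in the real coordinates x₁+ix₂, x₃+ix₄ has 2μ as its only nonvanishing diagonal entry, the 33-component, so the mass of the Higgs boson is √μ.) -/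
/-- The second derivative at `0` of `α q + β q²` for a quadratic polynomial `q = a + 2 b t + c t²`. -/
theorem iteratedDeriv_two_quadratic_comp_quadratic (α β a b c : ℝ) :
    iteratedDeriv 2 (fun t : ℝ => α * (a + 2 * b * t + c * t ^ 2) +
      β * (a + 2 * b * t + c * t ^ 2) ^ 2) 0 = 2 * α * c + β * (8 * b ^ 2 + 4 * a * c) := by
  have hq (t : ℝ) : HasDerivAt (fun t : ℝ => a + 2 * b * t + c * t ^ 2) (2 * b + 2 * c * t) t := by
    refine ((((hasDerivAt_id' t).const_mul (2 * b)).const_add a).add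
      ((hasDerivAt_pow 2 t).const_mul c)).congr_deriv ?_
    norm_num
    ring
  have hq' : HasDerivAt (fun t : ℝ => 2 * b + 2 * c * t) (2 * c) 0 := by
    simpa using ((hasDerivAt_id' (0 : ℝ)).const_mul (2 * c)).const_add (2 * b)
  have h1 : deriv (fun t : ℝ => α * (a + 2 * b * t + c * t ^ 2) +
      β * (a + 2 * b * t + c * t ^ 2) ^ 2) = fun t =>
      α * (2 * b + 2 * c * t) + 2 * β * ((a + 2 * b * t + c * t ^ 2) * (2 * b + 2 * c * t)) := by
    funext t
    refine (((hq t).const_mul α).add (((hq t).pow 2).const_mul β)).deriv.trans ?_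
    norm_num
    ring
  rw [iteratedDeriv_succ, iteratedDeriv_one, h1]
  refine ((hq'.const_mul α).add (((hq 0).mul hq').const_mul (2 * β))).deriv.trans ?_
  ring

/-- The second directional derivative of `-(μ/2)‖v‖² + (lam/2)‖v‖⁴` at a point `v` in direction
`u`. -/
theorem iteratedDeriv_two_higgsPotential {E : Type*} [NormedAddCommGroup E]
    [InnerProductSpace ℂ E] (μ lam : ℝ) (V : E → ℝ)
    (hV : ∀ v, V v = -(μ / 2) * ‖v‖ ^ 2 + (lam / 2) * ‖v‖ ^ 4) (v u : E) :
    iteratedDeriv 2 (fun t : ℝ => V (v + t • u)) 0 =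
      (2 * lam * ‖v‖ ^ 2 - μ) * ‖u‖ ^ 2 + 4 * lam * (inner ℂ v u).re ^ 2 := by
  have hnorm (t : ℝ) : ‖v + t • u‖ ^ 2 =
      ‖v‖ ^ 2 + 2 * (inner ℂ v u).re * t + ‖u‖ ^ 2 * t ^ 2 := by
    rw [norm_add_sq (𝕜 := ℂ), ← Complex.coe_smul t u, inner_smul_right, norm_smul, mul_pow]
    simp
    ring
  have hfun : (fun t : ℝ => V (v + t • u)) = fun t =>
      -(μ / 2) * (‖v‖ ^ 2 + 2 * (inner ℂ v u).re * t + ‖u‖ ^ 2 * t ^ 2) +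
      (lam / 2) * (‖v‖ ^ 2 + 2 * (inner ℂ v u).re * t + ‖u‖ ^ 2 * t ^ 2) ^ 2 := by
    funext t
    rw [hV, ← hnorm]
    ring
  rw [hfun, iteratedDeriv_two_quadratic_comp_quadratic]
  ring


/-- At the vacuum `v₀ = (0, √(μ/(2λ)))` the Hessian of the Higgs potential
`V(v) = −(μ/2)‖v‖² + (λ/2)‖v‖⁴` has second derivative `2μ` in the direction `(0,1)`
and `0` in the directions `(1,0)`, `(i,0)`, `(0,i)`; hence the Higgs boson has
mass `√μ`. -/
theorem higgs_hessian_at_vacuum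
    (μ lam : ℝ) (hμ : 0 < μ) (hlam : 0 < lam)
    (V : EuclideanSpace ℂ (Fin 2) → ℝ)
    (hV : ∀ v, V v = -(μ / 2) * ‖v‖ ^ 2 + (lam / 2) * ‖v‖ ^ 4)
    (v₀ : EuclideanSpace ℂ (Fin 2))
    (hv₀ : v₀ = (WithLp.equiv 2 (Fin 2 → ℂ)).symm ![0, (Real.sqrt (μ / (2 * lam)) : ℂ)]) :
    iteratedDeriv 2 (fun t : ℝ =>
        V (v₀ + t • (WithLp.equiv 2 (Fin 2 → ℂ)).symm ![0, 1])) 0 = 2 * μ ∧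
    iteratedDeriv 2 (fun t : ℝ =>
        V (v₀ + t • (WithLp.equiv 2 (Fin 2 → ℂ)).symm ![1, 0])) 0 = 0 ∧
    iteratedDeriv 2 (fun t : ℝ =>
        V (v₀ + t • (WithLp.equiv 2 (Fin 2 → ℂ)).symm ![Complex.I, 0])) 0 = 0 ∧
    iteratedDeriv 2 (fun t : ℝ =>
        V (v₀ + t • (WithLp.equiv 2 (Fin 2 → ℂ)).symm ![0, Complex.I])) 0 = 0 := by
  have hsq : Real.sqrt (μ / (2 * lam)) ^ 2 = μ / (2 * lam) := Real.sq_sqrt (by positivity)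
  have hnorm : ‖v₀‖ ^ 2 = μ / (2 * lam) := by
    rw [hv₀, EuclideanSpace.norm_sq_eq]
    simp [Fin.sum_univ_two, hsq]
  have hvac : 2 * lam * ‖v₀‖ ^ 2 - μ = 0 := by
    rw [hnorm]
    field_simp
    ring
  simp only [iteratedDeriv_two_higgsPotential μ lam V hV, hvac, zero_mul, zero_add]
  subst hv₀
  refine ⟨?_, ?_, ?_, ?_⟩
  · simp [PiLp.inner_apply, Fin.sum_univ_two, hsq]
    field_simp
    ring
  all_goals simp [PiLp.inner_apply, Fin.sum_univ_two]
end

section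
/- Let g > 0 and g' > 0 be real coupling constants and r ≥ 0 a real number. Let σ₁ = [[0,1],[1,0]], σ₂ = [[0,−i],[i,0]], σ₃ = [[1,0],[0,−1]] be the Pauli matrices, and define β_l = g·(i/2)·σ_l for l = 1,2,3 and β₄ = g'·(i/2)·1₂ (where 1₂ is the 2×2 identity matrix). Let v₀ = (0, r) ∈ ℂ² and define m(i,j) = Re⟨β_i·v₀, β_j·v₀⟩ using the standard Hermitian inner product on ℂ². Then the 4×4 real matrix (m(i,j))_{i,j=1..4} equals (r²/4)·[[g², 0, 0, 0], [0, g², 0, 0], [0, 0, g², −g·g'], [0, 0, −g·g', g'²]]. -/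
open Matrix

/-- The Pauli matrices `σ₁, σ₂, σ₃`. -/
noncomputable def pauliEW : Fin 3 → Matrix (Fin 2) (Fin 2) ℂ :=
  ![!![0, 1; 1, 0], !![0, -Complex.I; Complex.I, 0], !![1, 0; 0, -1]]

/-- The generators `β₁, β₂, β₃, β₄` of `su(2) ⊕ u(1)` acting on the Higgs space `ℂ²`:
`β_l = g·(i/2)·σ_l` for `l = 1,2,3` and `β₄ = g'·(i/2)·1₂`. -/
noncomputable def betaEW (g g' : ℝ) : Fin 4 → Matrix (Fin 2) (Fin 2) ℂ :=
  ![((g : ℂ) * Complex.I / 2) • pauliEW 0,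
    ((g : ℂ) * Complex.I / 2) • pauliEW 1,
    ((g : ℂ) * Complex.I / 2) • pauliEW 2,
    ((g' : ℂ) * Complex.I / 2) • (1 : Matrix (Fin 2) (Fin 2) ℂ)]

/-- The standard Hermitian inner product `⟨a, b⟩ = ā₁b₁ + ā₂b₂` on `ℂ²`. -/
noncomputable def innC2 (a b : Fin 2 → ℂ) : ℂ :=
  star (a 0) * b 0 + star (a 1) * b 1

/-- The mass form `m(i,j) = Re⟨β_i v₀, β_j v₀⟩` for the electroweak theory with vacuum
vector `v₀ = (0, r)` equals `(r²/4)·[[g²,0,0,0],[0,g²,0,0],[0,0,g²,−gg'],[0,0,−gg',g'²]]`. -/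
theorem electroweak_mass_form_matrix
    (g g' r : ℝ) (hg : 0 < g) (hg' : 0 < g') (hr : 0 ≤ r) :
    ∀ i j : Fin 4,
      (innC2 (betaEW g g' i *ᵥ ![0, (r : ℂ)]) (betaEW g g' j *ᵥ ![0, (r : ℂ)])).re
        = (r ^ 2 / 4) *
          !![g ^ 2, 0, 0, 0;
             0, g ^ 2, 0, 0;
             0, 0, g ^ 2, -(g * g');
             0, 0, -(g * g'), g' ^ 2] i j := by
  have h : ∀ i : Fin 4, betaEW g g' i *ᵥ ![0, (r : ℂ)] =
      ![![g * r * Complex.I / 2, 0], ![g * r / 2, 0], ![0, -(g * r * Complex.I / 2)],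
        ![0, g' * r * Complex.I / 2]] i := by
    intro i
    ext k
    fin_cases i <;> fin_cases k <;>
      simp [betaEW, pauliEW, mulVec, dotProduct, Fin.sum_univ_two] <;>
      ring_nf <;> simp <;> ring
  intro i j
  rw [h, h]
  fin_cases i <;> fin_cases j <;> simp [innC2] <;> ring
end
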